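/- arXiv:1202.4513 — 4 statements merged into one kernel-verified Lean document; each statement's English description precedes it below -/
import Mathlib

section
/- Let E be a finite-dimensional real inner product space equipped with a bilinear, commutative product • satisfying the Jordan identity (a•a)•(a•b) = a•((a•a)•b), with unit u, such that the inner product is associative (⟨a•b, c⟩ = ⟨b, a•c⟩ for all a,b,c) and is self-dualizing for the cone of squares C = {a•a : a ∈ E} (i.e., C = {y : ⟨x,y⟩ ≥ 0 for all x ∈ C}). Assume further that ⟨e, e⟩ = 1 and ⟨e, u⟩ = 1 for every primitive idempotent e (as holds for the trace inner product of a Euclidean Jordan algebra). Let x ∈ E be such that (i) t·x is a primitive idempotent for some real t > 0, (ii) x belongs to a finite family (x_i) of elements of C with Σ_i x_i = u, and (iii) there is a primitive idempotent f with ⟨f, x⟩ = 1. Then t = 1, i.e., x is itself a primitive idempotent. -/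
open scoped RealInnerProductSpace

/-- An idempotent for the commutative product `m`: a nonzero element with `p • p = p`. -/
def IsJordanIdempotent {E : Type*} [NormedAddCommGroup E] [InnerProductSpace ℝ E]
    (m : E →ₗ[ℝ] E →ₗ[ℝ] E) (p : E) : Prop :=
  p ≠ 0 ∧ m p p = p

/-- A primitive idempotent: an idempotent which is not the sum of two distinct nonzero
idempotents. -/
def IsPrimitiveIdempotent {E : Type*} [NormedAddCommGroup E] [InnerProductSpace ℝ E]
    (m : E →ₗ[ℝ] E →ₗ[ℝ] E) (p : E) : Prop :=
  IsJordanIdempotent m p ∧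
    ¬∃ q r : E, IsJordanIdempotent m q ∧ IsJordanIdempotent m r ∧ q ≠ r ∧ p = q + r

/-- Lemma 6(a) of the paper.  In a Euclidean Jordan algebra with
self-dualizing associative inner product, if `x` is a positive multiple `t⁻¹` of a primitive
idempotent, belongs to a finite family of cone elements summing to the unit, and is assigned
probability `1` by some primitive idempotent, then `t = 1`, i.e. `x` is itself a primitive
idempotent. -/
theorem extremal_unital_outcome_is_primitive_idempotent
    {E : Type*} [NormedAddCommGroup E] [InnerProductSpace ℝ E] [FiniteDimensional ℝ E]
    (m : E →ₗ[ℝ] E →ₗ[ℝ] E)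
    (hcomm : ∀ a b : E, m a b = m b a)
    (hjordan : ∀ a b : E, m (m a a) (m a b) = m a (m (m a a) b))
    (u : E) (hunit : ∀ a : E, m u a = a)
    (hassoc : ∀ a b c : E, ⟪m a b, c⟫ = ⟪b, m a c⟫)
    (hsd : {z : E | ∃ a : E, m a a = z} =
      {y : E | ∀ x ∈ {z : E | ∃ a : E, m a a = z}, 0 ≤ ⟪x, y⟫})
    (htrace : ∀ e : E, IsPrimitiveIdempotent m e → ⟪e, e⟫ = 1 ∧ ⟪e, u⟫ = 1)
    (x : E) (t : ℝ) (ht : 0 < t)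
    (hprim : IsPrimitiveIdempotent m (t • x))
    (ι : Type) (_ : Fintype ι) (xi : ι → E) (i₀ : ι)
    (hx : xi i₀ = x)
    (hxi : ∀ i : ι, xi i ∈ {z : E | ∃ a : E, m a a = z})
    (hsum : ∑ i, xi i = u)
    (f : E) (hf : IsPrimitiveIdempotent m f) (hfx : ⟪f, x⟫ = 1) :
    t = 1 := by
  have hpos : ∀ i, 0 ≤ ⟪t • x, xi i⟫ := by
    intro i
    have h := hxi i
    rw [hsd] at h
    exact h (t • x) ⟨t • x, hprim.1.2⟩
  obtain ⟨hee, heu⟩ := htrace _ hprim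
  obtain ⟨hff, -⟩ := htrace _ hf
  have h1 : ⟪t • x, xi i₀⟫ ≤ 1 := by
    rw [← heu, ← hsum, inner_sum]
    exact Finset.single_le_sum (fun i _ => hpos i) (Finset.mem_univ i₀)
  have h2 : t * ⟪t • x, x⟫ = 1 := by
    rw [← hee, inner_smul_right (t • x) x t]
  rw [hx] at h1
  have h3 : 0 ≤ ⟪f - t • x, f - t • x⟫ := real_inner_self_nonneg
  have h4 : ⟪f, t • x⟫ = t := by
    rw [inner_smul_right, hfx, mul_one]
  rw [real_inner_sub_sub_self, hff, hee, h4] at h3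
  have h5 : t ≤ 1 := by linarith
  have h6 : t * ⟪t • x, x⟫ ≤ t * 1 := mul_le_mul_of_nonneg_left h1 ht.le
  linarith
end

section
/- Let E be a finite-dimensional real vector space and C ⊆ E a closed, pointed, convex cone with nonempty interior. Let K be a compact subgroup of GL(E) (with the norm topology) such that g(C) = C for every g ∈ K. Then there exists a point a in the interior of C with g a = a for all g ∈ K. -/
set_option maxHeartbeats 1000000 in
/-- A compact group of linear automorphisms of a proper cone `C` in a
finite-dimensional real vector space has a fixed point in the interior of `C`. -/
theorem compact_subgroup_fixes_interior_point
    {E : Type*} [NormedAddCommGroup E] [NormedSpace ℝ E] [FiniteDimensional ℝ E]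
    (C : Set E) (hclosed : IsClosed C) (hconv : Convex ℝ C)
    (hcone : ∀ t : ℝ, 0 < t → ∀ x ∈ C, t • x ∈ C)
    (hpointed : C ∩ (-C) = {0})
    (hint : (interior C).Nonempty)
    (K : Subgroup (E →L[ℝ] E)ˣ)
    (hKcpt : IsCompact ((fun g : (E →L[ℝ] E)ˣ => (g : E →L[ℝ] E)) '' (K : Set (E →L[ℝ] E)ˣ)))
    (hKC : ∀ g ∈ K, ((g : E →L[ℝ] E)) '' C = C) :
    ∃ a ∈ interior C, ∀ g ∈ K, (g : E →L[ℝ] E) a = a := by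
  obtain ⟨x0, hx0⟩ := hint
  set M : Set (E →L[ℝ] E) :=
    (fun g : (E →L[ℝ] E)ˣ => (g : E →L[ℝ] E)) '' (K : Set (E →L[ℝ] E)ˣ) with hM
  have hinv : ∀ (g : (E →L[ℝ] E)ˣ) (v : E),
      ((g⁻¹ : (E →L[ℝ] E)ˣ) : E →L[ℝ] E) ((g : E →L[ℝ] E) v) = v := by
    intro g v
    have h : (((g⁻¹ : (E →L[ℝ] E)ˣ) : E →L[ℝ] E) * (g : E →L[ℝ] E)) v = v := by
      rw [Units.inv_mul]; rfl
    exact h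
  have hinv2 : ∀ (g : (E →L[ℝ] E)ˣ) (v : E),
      (g : E →L[ℝ] E) (((g⁻¹ : (E →L[ℝ] E)ˣ) : E →L[ℝ] E) v) = v := by
    intro g v
    have h : ((g : E →L[ℝ] E) * ((g⁻¹ : (E →L[ℝ] E)ˣ) : E →L[ℝ] E)) v = v := by
      rw [Units.mul_inv]; rfl
    exact h
  let O : Set E := (fun A : E →L[ℝ] E => A x0) '' M
  have hOc : IsCompact O := hKcpt.image (by fun_prop)
  let S : Set E := closure (convexHull ℝ O)
  have hSconv : Convex ℝ S := (convex_convexHull ℝ O).closure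
  have hSsub : O ⊆ S := (subset_convexHull ℝ O).trans subset_closure
  have hSmin : ∀ T : Set E, IsClosed T → Convex ℝ T → O ⊆ T → S ⊆ T := fun T h1 h2 h3 =>
    closure_minimal (convexHull_min h3 h2) h1
  have hSc : IsCompact S :=
    Metric.isCompact_of_isClosed_isBounded isClosed_closure
      (isBounded_convexHull.2 hOc.isBounded).closure
  have hOint : O ⊆ interior C := by
    rintro _ ⟨_, ⟨g, hg, rfl⟩, rfl⟩
    have hopen : IsOpen (((g⁻¹ : (E →L[ℝ] E)ˣ) : E →L[ℝ] E) ⁻¹' interior C) :=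
      isOpen_interior.preimage (ContinuousLinearMap.continuous _)
    have hsub : (((g⁻¹ : (E →L[ℝ] E)ˣ) : E →L[ℝ] E) ⁻¹' interior C) ⊆ C := by
      intro y hy
      rw [← hKC g hg]
      exact ⟨_, interior_subset hy, hinv2 g y⟩
    apply interior_maximal hsub hopen
    show ((g⁻¹ : (E →L[ℝ] E)ˣ) : E →L[ℝ] E) ((g : E →L[ℝ] E) x0) ∈ interior C
    rw [hinv]; exact hx0
  have hSint : S ⊆ interior C := by
    obtain ⟨ε, hε, hεC⟩ := hOc.exists_cthickening_subset_open isOpen_interior hOint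
    have hT : S ⊆ ⋂ u ∈ Metric.closedBall (0 : E) ε, (fun z => z + u) ⁻¹' C := by
      apply hSmin
      · exact isClosed_biInter fun u _ => hclosed.preimage (by fun_prop)
      · exact convex_iInter₂ fun u _ => hconv.translate_preimage_left u
      · intro z hz
        simp only [Set.mem_iInter]
        intro u hu
        apply interior_subset (hεC _)
        apply Metric.mem_cthickening_of_dist_le _ z ε O hz
        simpa [dist_eq_norm] using hu
    intro z hz
    rw [mem_interior_iff_mem_nhds, Metric.mem_nhds_iff]
    refine ⟨ε, hε, fun y hy => ?_⟩
    have h := hT hz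
    simp only [Set.mem_iInter] at h
    have h' := h (y - z) (by
      rw [mem_closedBall_zero_iff, ← dist_eq_norm]
      exact (Metric.mem_ball.1 hy).le)
    simpa using h'
  have hMmul : ∀ A ∈ M, ∀ g ∈ K, A * (g : E →L[ℝ] E) ∈ M := by
    rintro _ ⟨h, hh, rfl⟩ g hg
    exact ⟨h * g, K.mul_mem hh hg, rfl⟩
  have hSinv : ∀ g ∈ K, ∀ v ∈ S, (g : E →L[ℝ] E) v ∈ S := by
    intro g hg
    have : S ⊆ (g : E →L[ℝ] E) ⁻¹' S := by
      apply hSmin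
      · exact isClosed_closure.preimage (ContinuousLinearMap.continuous _)
      · exact hSconv.linear_preimage (g : E →L[ℝ] E).toLinearMap
      · rintro _ ⟨_, ⟨h, hh, rfl⟩, rfl⟩
        exact hSsub ⟨_, ⟨g * h, K.mul_mem hg hh, rfl⟩, rfl⟩
    exact this
  have h1M : (1 : E →L[ℝ] E) ∈ M := ⟨1, K.one_mem, rfl⟩
  have hSne : S.Nonempty := ⟨_, hSsub ⟨1, h1M, rfl⟩⟩
  let e := toEuclidean (E := E)
  let f : E → (E →L[ℝ] E) → ℝ := fun v A => ‖e (A v)‖ ^ 2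
  have hf : Continuous (Function.uncurry f) := by
    show Continuous fun p : E × (E →L[ℝ] E) => ‖e (p.2 p.1)‖ ^ 2
    fun_prop
  have hN : Continuous fun v => sSup (f v '' M) := hKcpt.continuous_sSup hf
  have hfv : ∀ v, Continuous (f v) := fun v => by
    show Continuous fun A : E →L[ℝ] E => ‖e (A v)‖ ^ 2
    fun_prop
  have hle : ∀ v, ∀ A ∈ M, f v A ≤ sSup (f v '' M) := fun v A hA =>
    le_csSup (hKcpt.image (hfv v)).bddAbove ⟨A, hA, rfl⟩
  obtain ⟨m, hmS, hmin⟩ := hSc.exists_isMinOn hSne hN.continuousOn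
  refine ⟨m, hSint hmS, fun g hg => ?_⟩
  obtain ⟨w, hw⟩ : ∃ w, w = (g : E →L[ℝ] E) m := ⟨_, rfl⟩
  have hwS : w ∈ S := hw ▸ hSinv g hg m hmS
  rw [← hw]
  have hmid : (1/2 : ℝ) • m + (1/2 : ℝ) • w ∈ S :=
    hSconv hmS hwS (by norm_num) (by norm_num) (by norm_num)
  have hex : ∃ A ∈ M, f ((1/2 : ℝ) • m + (1/2 : ℝ) • w) A =
      sSup (f ((1/2 : ℝ) • m + (1/2 : ℝ) • w) '' M) :=
    (hKcpt.image (hfv ((1/2 : ℝ) • m + (1/2 : ℝ) • w))).sSup_mem (Set.Nonempty.image _ ⟨1, h1M⟩)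
  obtain ⟨A, hA, hAe⟩ := hex
  have h1 : sSup (f m '' M) ≤ sSup (f ((1/2 : ℝ) • m + (1/2 : ℝ) • w) '' M) :=
    isMinOn_iff.1 hmin _ hmid
  rw [← hAe] at h1
  have h2 := hle m A hA
  have h3 : ‖e (A w)‖ ^ 2 ≤ sSup (f m '' M) := by
    have h := hle m _ (hMmul A hA g hg)
    rw [hw]
    exact h
  have h4 := parallelogram_law_with_norm ℝ (e (A m)) (e (A w))
  have h5 : f ((1/2 : ℝ) • m + (1/2 : ℝ) • w) A = (1/4) * ‖e (A m) + e (A w)‖ ^ 2 := by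
    show ‖e (A ((1/2 : ℝ) • m + (1/2 : ℝ) • w))‖ ^ 2 = _
    rw [← smul_add, map_smul, map_smul, norm_smul, map_add, map_add, mul_pow]
    norm_num
  have h2' : ‖e (A m)‖ ^ 2 ≤ sSup (f m '' M) := h2
  have h6 : ‖e (A m) - e (A w)‖ ^ 2 ≤ 0 := by
    rw [h5] at h1
    nlinarith
  have h7 : e (A m) - e (A w) = 0 := by
    have := sq_nonneg ‖e (A m) - e (A w)‖
    exact norm_eq_zero.1 (pow_eq_zero_iff (two_ne_zero)|>.1 (le_antisymm h6 this))
  have h8 : A m = A w := e.injective (sub_eq_zero.1 h7)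
  obtain ⟨h, hh, rfl⟩ := hA
  have h9 := congrArg ((h⁻¹ : (E →L[ℝ] E)ˣ) : E →L[ℝ] E) h8
  simp only [hinv] at h9
  exact h9.symm
end

section
/- Let E be a finite-dimensional real vector space and C ⊆ E a closed, pointed, convex cone with nonempty interior, and let a be a point in the interior of C. Then the stabilizer {g ∈ GL(E) : g(C) = C and g a = a} is a compact subgroup of GL(E). -/
lemma aux_interval_bounded
    {E : Type*} [NormedAddCommGroup E] [NormedSpace ℝ E] [FiniteDimensional ℝ E]
    (C : Set E) (hclosed : IsClosed C)
    (hcone : ∀ t : ℝ, 0 < t → ∀ x ∈ C, t • x ∈ C)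
    (hpointed : C ∩ (-C) = {0}) (a : E) :
    ∃ M : ℝ, 0 < M ∧ ∀ x : E, a + x ∈ C → a - x ∈ C → ‖x‖ ≤ M := by
  have : ProperSpace E := FiniteDimensional.proper_real E
  let D : Set (ℝ × E) := (Set.Icc (0:ℝ) 1 ×ˢ Metric.sphere (0:E) 1) ∩
    {p | p.1 • a + p.2 ∈ C ∧ p.1 • a - p.2 ∈ C}
  have hD : IsCompact D := by
    apply (isCompact_Icc.prod (isCompact_sphere (0:E) 1)).inter_right
    exact (hclosed.preimage (f := fun p : ℝ × E => p.1 • a + p.2) (by fun_prop)).inter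
      (hclosed.preimage (f := fun p : ℝ × E => p.1 • a - p.2) (by fun_prop))
  have hI : IsClosed (Prod.fst '' D) := (hD.image continuous_fst).isClosed
  have h0 : (0:ℝ) ∈ (Prod.fst '' D)ᶜ := by
    rintro ⟨⟨t, v⟩, ⟨⟨_, hv⟩, h1, h2⟩, rfl⟩
    simp only [zero_smul, zero_add, zero_sub] at h1 h2
    have : v ∈ C ∩ (-C) := ⟨h1, h2⟩
    rw [hpointed] at this
    simp only [Set.mem_singleton_iff] at this
    simp [this] at hv
  obtain ⟨ε, hε, hb⟩ := Metric.isOpen_iff.1 hI.isOpen_compl 0 h0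
  refine ⟨max 1 (1/ε), by positivity, fun x h1 h2 => ?_⟩
  by_contra! hx
  have hx1 : 1 < ‖x‖ := lt_of_le_of_lt (le_max_left _ _) hx
  have hx2 : 1/ε < ‖x‖ := lt_of_le_of_lt (le_max_right _ _) hx
  have hpos : 0 < ‖x‖ := by linarith
  have hinv : 0 < ‖x‖⁻¹ := by positivity
  have hlt : ‖x‖⁻¹ < ε := by
    rw [inv_lt_comm₀ hpos hε]; simpa using hx2
  have hmem : ‖x‖⁻¹ ∈ Metric.ball (0:ℝ) ε := by
    simpa [abs_of_pos hinv] using hlt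
  refine hb hmem ⟨(‖x‖⁻¹, ‖x‖⁻¹ • x), ⟨⟨⟨hinv.le, inv_le_one_of_one_le₀ hx1.le⟩, ?_⟩, ?_, ?_⟩, rfl⟩
  · simp [norm_smul, hpos.ne']
  · have := hcone _ hinv _ h1
    rwa [smul_add] at this
  · have := hcone _ hinv _ h2
    rwa [smul_sub] at this

lemma aux_norm_bound
    {E : Type*} [NormedAddCommGroup E] [NormedSpace ℝ E] [FiniteDimensional ℝ E]
    (C : Set E) (hclosed : IsClosed C)
    (hcone : ∀ t : ℝ, 0 < t → ∀ x ∈ C, t • x ∈ C)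
    (hpointed : C ∩ (-C) = {0}) (a : E) (ha : a ∈ interior C) :
    ∃ R : ℝ, ∀ f : E →L[ℝ] E, (∀ x ∈ C, f x ∈ C) → f a = a → ‖f‖ ≤ R := by
  obtain ⟨M, hM, hB⟩ := aux_interval_bounded C hclosed hcone hpointed a
  obtain ⟨r, hr, hball⟩ := Metric.nhds_basis_closedBall.mem_iff.1 (mem_interior_iff_mem_nhds.1 ha)
  refine ⟨M / r, fun f hf hfa => f.opNorm_le_bound (by positivity) fun x => ?_⟩
  rcases eq_or_ne x 0 with rfl | hx
  · simp
  have hpos : 0 < ‖x‖ := norm_pos_iff.2 hx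
  have hn : ‖(r / ‖x‖) • x‖ = r := by
    rw [norm_smul, Real.norm_of_nonneg (by positivity)]; field_simp
  have h1 : a + f ((r / ‖x‖) • x) ∈ C := by
    have := hf (a + (r / ‖x‖) • x) (hball (by simp only [Metric.mem_closedBall, dist_self_add_left, hn, le_refl]))
    rwa [map_add, hfa] at this
  have h2 : a - f ((r / ‖x‖) • x) ∈ C := by
    have := hf (a - (r / ‖x‖) • x) (hball (by
      rw [Metric.mem_closedBall, dist_eq_norm, sub_sub_cancel_left, norm_neg, hn]))
    rwa [map_sub, hfa] at this
  have h3 := hB _ h1 h2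
  rw [map_smul, norm_smul, Real.norm_of_nonneg (by positivity)] at h3
  have : ‖f x‖ = (‖x‖ / r) * (r / ‖x‖ * ‖f x‖) := by field_simp
  rw [this]
  calc _ ≤ (‖x‖ / r) * M := by gcongr
    _ = _ := by ring

/-- The stabilizer of an interior point of a proper cone `C`, inside the
group of linear automorphisms of `C`, is a compact subgroup of `GL(E)`. -/
theorem stabilizer_of_interior_point_compact
    {E : Type*} [NormedAddCommGroup E] [NormedSpace ℝ E] [FiniteDimensional ℝ E]
    (C : Set E) (hclosed : IsClosed C) (hconv : Convex ℝ C)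
    (hcone : ∀ t : ℝ, 0 < t → ∀ x ∈ C, t • x ∈ C)
    (hpointed : C ∩ (-C) = {0})
    (hint : (interior C).Nonempty)
    (a : E) (ha : a ∈ interior C) :
    ∃ K : Subgroup (E →L[ℝ] E)ˣ,
      (K : Set (E →L[ℝ] E)ˣ) =
        {g : (E →L[ℝ] E)ˣ | (g : E →L[ℝ] E) '' C = C ∧ (g : E →L[ℝ] E) a = a} ∧
      IsCompact ((fun g : (E →L[ℝ] E)ˣ => (g : E →L[ℝ] E)) '' (K : Set (E →L[ℝ] E)ˣ)) := by
  have hl : ∀ (g : (E →L[ℝ] E)ˣ) (x : E), (↑g⁻¹ : E →L[ℝ] E) ((g : E →L[ℝ] E) x) = x := by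
    intro g x
    rw [← ContinuousLinearMap.mul_apply, Units.inv_mul, ContinuousLinearMap.one_apply]
  have hinv : ∀ g : (E →L[ℝ] E)ˣ, (g : E →L[ℝ] E) '' C = C → (g : E →L[ℝ] E) a = a →
      (↑g⁻¹ : E →L[ℝ] E) '' C = C ∧ (↑g⁻¹ : E →L[ℝ] E) a = a := by
    intro g h1 h2
    constructor
    · conv_lhs => rw [← h1]
      rw [Set.image_image]
      simp [hl]
    · conv_lhs => rw [← h2]
      exact hl g a
  refine ⟨{ carrier := {g : (E →L[ℝ] E)ˣ | (g : E →L[ℝ] E) '' C = C ∧ (g : E →L[ℝ] E) a = a}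
            mul_mem' := ?_, one_mem' := ?_, inv_mem' := ?_ }, rfl, ?_⟩
  · rintro g h ⟨g1, g2⟩ ⟨h1, h2⟩
    refine ⟨?_, ?_⟩
    · have : ((g * h : (E →L[ℝ] E)ˣ) : E →L[ℝ] E) '' C
          = (g : E →L[ℝ] E) '' ((h : E →L[ℝ] E) '' C) := by
        rw [Set.image_image]; rfl
      rw [this, h1, g1]
    · rw [Units.val_mul, ContinuousLinearMap.mul_apply, h2, g2]
  · exact ⟨by simp, by simp⟩
  · rintro g ⟨h1, h2⟩
    exact hinv g h1 h2
  · obtain ⟨R, hR⟩ := aux_norm_bound C hclosed hcone hpointed a ha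
    have : ProperSpace (E →L[ℝ] E) := FiniteDimensional.proper_real _
    let T : Set ((E →L[ℝ] E) × (E →L[ℝ] E)) :=
      {p | (p.1 * p.2 = 1 ∧ p.2 * p.1 = 1) ∧ (p.1 a = a ∧ p.2 a = a) ∧
        ∀ x ∈ C, p.1 x ∈ C ∧ p.2 x ∈ C}
    have hTc : IsClosed T := by
      have e1 (x : E) : Continuous fun p : (E →L[ℝ] E) × (E →L[ℝ] E) => p.1 x := by fun_prop
      have e2 (x : E) : Continuous fun p : (E →L[ℝ] E) × (E →L[ℝ] E) => p.2 x := by fun_prop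
      refine IsClosed.and ?_ (IsClosed.and ?_ ?_)
      · exact (isClosed_eq (by fun_prop) (by fun_prop)).and
          (isClosed_eq (by fun_prop) (by fun_prop))
      · exact (isClosed_eq (e1 a) (by fun_prop)).and (isClosed_eq (e2 a) (by fun_prop))
      · simp only [Set.setOf_forall]
        exact isClosed_iInter fun x => isClosed_iInter fun _ =>
          (hclosed.preimage (e1 x)).inter (hclosed.preimage (e2 x))
    have hT : IsCompact T := by
      refine ((isCompact_closedBall (0 : E →L[ℝ] E) R).prod
        (isCompact_closedBall (0 : E →L[ℝ] E) R)).of_isClosed_subset hTc ?_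
      rintro ⟨f, h⟩ ⟨_, ⟨h1, h2⟩, h3⟩
      exact ⟨mem_closedBall_zero_iff.2 (hR f (fun x hx => (h3 x hx).1) h1),
        mem_closedBall_zero_iff.2 (hR h (fun x hx => (h3 x hx).2) h2)⟩
    convert hT.image continuous_fst using 1
    ext f
    constructor
    · rintro ⟨g, ⟨h1, h2⟩, rfl⟩
      obtain ⟨h3, h4⟩ := hinv g h1 h2
      refine ⟨((g : E →L[ℝ] E), (↑g⁻¹ : E →L[ℝ] E)), ⟨⟨g.mul_inv, g.inv_mul⟩, ⟨h2, h4⟩, ?_⟩, rfl⟩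
      intro x hx
      exact ⟨h1.subset (Set.mem_image_of_mem _ hx), h3.subset (Set.mem_image_of_mem _ hx)⟩
    · rintro ⟨⟨f, h⟩, ⟨⟨h1, h2⟩, ⟨h3, h4⟩, h5⟩, rfl⟩
      refine ⟨⟨f, h, h1, h2⟩, ⟨?_, h3⟩, rfl⟩
      apply Set.Subset.antisymm
      · rintro _ ⟨x, hx, rfl⟩
        exact (h5 x hx).1
      · intro x hx
        exact ⟨h x, (h5 x hx).2, congrArg (fun q : E →L[ℝ] E => q x) h1⟩
end

section
/- Let E be a finite-dimensional real vector space and C ⊆ E a closed, pointed, convex cone with nonempty interior that is homogeneous, i.e., the group Aut(C) = {g ∈ GL(E) : g(C) = C} acts transitively on the interior of C. Then a subgroup K of Aut(C) is a maximal compact subgroup of Aut(C) if and only if K is the stabilizer {g ∈ Aut(C) : g a = a} of some point a in the interior of C. Consequently, any two maximal compact subgroups K₁, K₂ of Aut(C) are conjugate: there exists g ∈ Aut(C) with K₂ = g K₁ g⁻¹. -/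
/-- `g` is an automorphism of the cone `C`. -/
def PreservesCone {E : Type*} [NormedAddCommGroup E] [NormedSpace ℝ E]
    (C : Set E) (g : (E →L[ℝ] E)ˣ) : Prop :=
  (g : E →L[ℝ] E) '' C = C

/-- `K` is compact in the operator-norm topology. -/
def IsCompactSubgroup {E : Type*} [NormedAddCommGroup E] [NormedSpace ℝ E]
    (K : Subgroup (E →L[ℝ] E)ˣ) : Prop :=
  IsCompact ((fun g : (E →L[ℝ] E)ˣ => (g : E →L[ℝ] E)) '' (K : Set (E →L[ℝ] E)ˣ))

/-- `K` is a maximal compact subgroup of `Aut(C)`: it consists of automorphisms of `C`,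
is compact, and is not properly contained in any compact subgroup of `Aut(C)`. -/
def IsMaximalCompactConeSubgroup {E : Type*} [NormedAddCommGroup E] [NormedSpace ℝ E]
    (C : Set E) (K : Subgroup (E →L[ℝ] E)ˣ) : Prop :=
  (∀ g ∈ K, PreservesCone C g) ∧ IsCompactSubgroup K ∧
    ∀ K' : Subgroup (E →L[ℝ] E)ˣ,
      (∀ g ∈ K', PreservesCone C g) → IsCompactSubgroup K' → K ≤ K' → K' = K

section Helpers
open MeasureTheory

variable {E : Type*} [NormedAddCommGroup E] [NormedSpace ℝ E]

lemma units_inv_apply (g : (E →L[ℝ] E)ˣ) (x : E) :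
    ((g⁻¹ : (E →L[ℝ] E)ˣ) : E →L[ℝ] E) ((g : E →L[ℝ] E) x) = x := by
  exact congrArg (fun T : E →L[ℝ] E => T x) g.inv_mul

lemma units_apply_inv (g : (E →L[ℝ] E)ˣ) (x : E) :
    (g : E →L[ℝ] E) (((g⁻¹ : (E →L[ℝ] E)ˣ) : E →L[ℝ] E) x) = x := by
  exact congrArg (fun T : E →L[ℝ] E => T x) g.mul_inv

lemma pc_iff {C : Set E} {g : (E →L[ℝ] E)ˣ} : PreservesCone C g ↔
    (∀ x ∈ C, (g : E →L[ℝ] E) x ∈ C) ∧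
    (∀ x ∈ C, ((g⁻¹ : (E →L[ℝ] E)ˣ) : E →L[ℝ] E) x ∈ C) := by
  unfold PreservesCone
  constructor
  · intro h
    refine ⟨fun x hx => h ▸ Set.mem_image_of_mem _ hx, fun x hx => ?_⟩
    rw [← h] at hx
    obtain ⟨y, hy, rfl⟩ := hx
    rwa [units_inv_apply]
  · rintro ⟨h1, h2⟩
    apply Set.Subset.antisymm
    · rintro _ ⟨x, hx, rfl⟩
      exact h1 x hx
    · intro x hx
      exact ⟨_, h2 x hx, units_apply_inv g x⟩

lemma pc_one (C : Set E) : PreservesCone C 1 := by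
  rw [pc_iff]; simp

lemma pc_mul {C : Set E} {g h : (E →L[ℝ] E)ˣ} (hg : PreservesCone C g)
    (hh : PreservesCone C h) : PreservesCone C (g * h) := by
  rw [pc_iff] at *
  refine ⟨fun x hx => ?_, fun x hx => ?_⟩
  · simpa using hg.1 _ (hh.1 _ hx)
  · rw [mul_inv_rev]
    simpa using hh.2 _ (hg.2 _ hx)

lemma pc_inv {C : Set E} {g : (E →L[ℝ] E)ˣ} (hg : PreservesCone C g) :
    PreservesCone C g⁻¹ := by
  rw [pc_iff] at *
  exact ⟨hg.2, by simpa using hg.1⟩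

/-- The stabilizer of a point in the automorphism group of the cone. -/
def coneStab (C : Set E) (a : E) : Subgroup (E →L[ℝ] E)ˣ where
  carrier := {g | PreservesCone C g ∧ (g : E →L[ℝ] E) a = a}
  one_mem' := ⟨pc_one C, by simp⟩
  mul_mem' := by
    rintro g h ⟨hg, hga⟩ ⟨hh, hha⟩
    exact ⟨pc_mul hg hh, by simp [hga, hha]⟩
  inv_mem' := by
    rintro g ⟨hg, hga⟩
    refine ⟨pc_inv hg, ?_⟩
    conv_lhs => rw [← hga]
    exact units_inv_apply g a

lemma mem_coneStab {C : Set E} {a : E} {g : (E →L[ℝ] E)ˣ} :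
    g ∈ coneStab C a ↔ PreservesCone C g ∧ (g : E →L[ℝ] E) a = a := Iff.rfl

lemma pc_interior {C : Set E} {g : (E →L[ℝ] E)ˣ} (hg : PreservesCone C g)
    {x : E} (hx : x ∈ interior C) : (g : E →L[ℝ] E) x ∈ interior C := by
  have hsub : ((g⁻¹ : (E →L[ℝ] E)ˣ) : E →L[ℝ] E) ⁻¹' (interior C) ⊆ C := by
    intro y hy
    have := (pc_iff.1 hg).1 _ (interior_subset hy)
    rwa [units_apply_inv] at this
  apply interior_maximal hsub (isOpen_interior.preimage (ContinuousLinearMap.continuous _))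
  simpa [units_inv_apply] using hx

lemma interval_bdd [FiniteDimensional ℝ E] {C : Set E} (hclosed : IsClosed C)
    (hcone : ∀ t : ℝ, 0 < t → ∀ x ∈ C, t • x ∈ C)
    (hpointed : C ∩ (-C) = {0}) (a : E) :
    ∃ M : ℝ, 0 ≤ M ∧ ∀ x : E, a + x ∈ C → a - x ∈ C → ‖x‖ ≤ M := by
  have hne : C.Nonempty := by
    have : (0 : E) ∈ C ∩ (-C) := by rw [hpointed]; rfl
    exact ⟨0, this.1⟩
  have hcont : Continuous (fun u : E => Metric.infDist u C + Metric.infDist (-u) C) :=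
    (Metric.continuous_infDist_pt C).add ((Metric.continuous_infDist_pt C).comp continuous_neg)
  obtain ⟨δ, hδ, hmin⟩ := (isCompact_sphere (0 : E) 1).exists_forall_le' hcont.continuousOn
    (a := 0) (by
      intro u hu
      by_contra hle
      have h1 : 0 ≤ Metric.infDist u C := Metric.infDist_nonneg
      have h2 : 0 ≤ Metric.infDist (-u) C := Metric.infDist_nonneg
      have e1 : Metric.infDist u C = 0 := by linarith
      have e2 : Metric.infDist (-u) C = 0 := by linarith
      have m1 := (hclosed.mem_iff_infDist_zero hne).2 e1
      have m2 := (hclosed.mem_iff_infDist_zero hne).2 e2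
      have : u ∈ C ∩ (-C) := ⟨m1, m2⟩
      rw [hpointed] at this
      have hu0 : u = 0 := this
      simp [hu0] at hu)
  refine ⟨2 * ‖a‖ / δ, by positivity, fun x h1 h2 => ?_⟩
  by_cases hx : x = 0
  · subst hx; simp; positivity
  have ht : 0 < ‖x‖ := norm_pos_iff.2 hx
  have hti : 0 < ‖x‖⁻¹ := inv_pos.2 ht
  have hs : ‖x‖⁻¹ • x ∈ Metric.sphere (0 : E) 1 := by
    simp [norm_smul, ht.ne']
  have h3 := hmin _ hs
  have b1 : Metric.infDist (‖x‖⁻¹ • x) C ≤ ‖x‖⁻¹ * ‖a‖ := by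
    refine (Metric.infDist_le_dist_of_mem (hcone _ hti _ h1)).trans_eq ?_
    rw [dist_eq_norm, smul_add, sub_add_cancel_right, norm_neg, norm_smul]
    simp
  have b2 : Metric.infDist (-(‖x‖⁻¹ • x)) C ≤ ‖x‖⁻¹ * ‖a‖ := by
    refine (Metric.infDist_le_dist_of_mem (hcone _ hti _ h2)).trans_eq ?_
    rw [dist_eq_norm, smul_sub]
    rw [show -(‖x‖⁻¹ • x) - (‖x‖⁻¹ • a - ‖x‖⁻¹ • x) = -(‖x‖⁻¹ • a) by abel, norm_neg, norm_smul]
    simp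
  have h4 : δ ≤ 2 * ‖a‖ / ‖x‖ := by
    rw [div_eq_inv_mul]; linarith
  rw [le_div_iff₀ ht] at h4
  rw [le_div_iff₀ hδ]
  linarith

lemma coneStab_compact [FiniteDimensional ℝ E] {C : Set E} (hclosed : IsClosed C)
    (hcone : ∀ t : ℝ, 0 < t → ∀ x ∈ C, t • x ∈ C)
    (hpointed : C ∩ (-C) = {0}) {a : E} (ha : a ∈ interior C) :
    IsCompactSubgroup (coneStab C a) := by
  obtain ⟨M, hM0, hM⟩ := interval_bdd hclosed hcone hpointed a
  obtain ⟨r, hr, hball⟩ := Metric.isOpen_iff.1 isOpen_interior a ha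
  have hbd : ∀ A : E →L[ℝ] E, A a = a → (∀ x ∈ C, A x ∈ C) → ‖A‖ ≤ 2 * M / r := by
    intro A hA hAC
    refine A.opNorm_le_bound (by positivity) fun x => ?_
    by_cases hx : x = 0
    · subst hx; simp
    have ht : 0 < ‖x‖ := norm_pos_iff.2 hx
    set c : ℝ := r / (2 * ‖x‖) with hc
    have hcpos : 0 < c := by positivity
    have hcn : ‖c • x‖ < r := by
      rw [norm_smul, Real.norm_of_nonneg hcpos.le, hc]
      field_simp
      linarith
    have p1 : a + c • x ∈ C := interior_subset (hball (by simpa [dist_eq_norm] using hcn))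
    have p2 : a - c • x ∈ C := interior_subset (hball (by simpa [dist_eq_norm] using hcn))
    have q1 := hAC _ p1
    have q2 := hAC _ p2
    rw [map_add, hA] at q1
    rw [map_sub, hA] at q2
    have := hM _ q1 q2
    rw [map_smul, norm_smul, Real.norm_of_nonneg hcpos.le, hc, div_mul_eq_mul_div,
      div_le_iff₀ (by positivity)] at this
    rw [div_mul_eq_mul_div, le_div_iff₀ hr]
    linarith
  let S : Set ((E →L[ℝ] E) × (E →L[ℝ] E)) :=
    {p | p.1 * p.2 = 1 ∧ p.2 * p.1 = 1 ∧ p.1 a = a ∧ p.2 a = a ∧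
      (∀ x ∈ C, p.1 x ∈ C) ∧ (∀ x ∈ C, p.2 x ∈ C)}
  have hSc : IsClosed S := by
    have ev1 : ∀ x : E, Continuous fun p : (E →L[ℝ] E) × (E →L[ℝ] E) => p.1 x := fun x =>
      (ContinuousLinearMap.apply ℝ E x).continuous.comp continuous_fst
    have ev2 : ∀ x : E, Continuous fun p : (E →L[ℝ] E) × (E →L[ℝ] E) => p.2 x := fun x =>
      (ContinuousLinearMap.apply ℝ E x).continuous.comp continuous_snd
    refine (isClosed_eq (continuous_fst.mul continuous_snd) continuous_const).inter <|
      (isClosed_eq (continuous_snd.mul continuous_fst) continuous_const).inter <|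
      (isClosed_eq (ev1 a) continuous_const).inter <|
      (isClosed_eq (ev2 a) continuous_const).inter <| IsClosed.inter ?_ ?_
    · have : IsClosed (⋂ x ∈ C, (fun p : (E →L[ℝ] E) × (E →L[ℝ] E) => p.1 x) ⁻¹' C) :=
        isClosed_biInter fun x _ => hclosed.preimage (ev1 x)
      have e : {p : (E →L[ℝ] E) × (E →L[ℝ] E) | ∀ x ∈ C, p.1 x ∈ C} =
          ⋂ x ∈ C, (fun p : (E →L[ℝ] E) × (E →L[ℝ] E) => p.1 x) ⁻¹' C := by
        ext p; simp
      rw [← e] at this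
      exact this
    · have : IsClosed (⋂ x ∈ C, (fun p : (E →L[ℝ] E) × (E →L[ℝ] E) => p.2 x) ⁻¹' C) :=
        isClosed_biInter fun x _ => hclosed.preimage (ev2 x)
      have e : {p : (E →L[ℝ] E) × (E →L[ℝ] E) | ∀ x ∈ C, p.2 x ∈ C} =
          ⋂ x ∈ C, (fun p : (E →L[ℝ] E) × (E →L[ℝ] E) => p.2 x) ⁻¹' C := by
        ext p; simp
      rw [← e] at this
      exact this
  have hSk : IsCompact S := by
    have : ProperSpace (E →L[ℝ] E) := FiniteDimensional.proper ℝ _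
    refine ((isCompact_closedBall (0 : E →L[ℝ] E) (2 * M / r)).prod
      (isCompact_closedBall (0 : E →L[ℝ] E) (2 * M / r))).of_isClosed_subset hSc ?_
    rintro ⟨A, B⟩ ⟨_, _, h3, h4, h5, h6⟩
    exact ⟨by simpa using hbd A h3 h5, by simpa using hbd B h4 h6⟩
  unfold IsCompactSubgroup
  convert hSk.image continuous_fst using 1
  ext T
  constructor
  · rintro ⟨g, hg, rfl⟩
    have hgi := (coneStab C a).inv_mem hg
    exact ⟨(g, (g⁻¹ : (E →L[ℝ] E)ˣ)), ⟨g.mul_inv, g.inv_mul, hg.2, hgi.2,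
      (pc_iff.1 hg.1).1, (pc_iff.1 hg.1).2⟩, rfl⟩
  · rintro ⟨⟨A, B⟩, ⟨h1, h2, h3, h4, h5, h6⟩, rfl⟩
    exact ⟨⟨A, B, h1, h2⟩, ⟨pc_iff.2 ⟨h5, h6⟩, h3⟩, rfl⟩

lemma exists_fixed [FiniteDimensional ℝ E] {C : Set E} (hclosed : IsClosed C) (hconv : Convex ℝ C)
    (hint : (interior C).Nonempty) (K : Subgroup (E →L[ℝ] E)ˣ)
    (hK : ∀ g ∈ K, PreservesCone C g) (hKc : IsCompactSubgroup K) :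
    ∃ b ∈ interior C, ∀ g ∈ K, (g : E →L[ℝ] E) b = b := by
  obtain ⟨a, ha⟩ := hint
  have : CompleteSpace E := FiniteDimensional.complete ℝ E
  have hKc' : IsCompact (K : Set (E →L[ℝ] E)ˣ) :=
    (Units.isOpenEmbedding_val (R := E →L[ℝ] E)).isInducing.isCompact_iff.2 hKc
  have : CompactSpace K := isCompact_iff_compactSpace.1 hKc'
  let : MeasurableSpace K := borel K
  have : BorelSpace K := ⟨rfl⟩
  let μ : Measure K := Measure.haarMeasure ⊤
  have : IsProbabilityMeasure μ := ⟨Measure.haarMeasure_self⟩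
  let f : K → E := fun k => ((k : (E →L[ℝ] E)ˣ) : E →L[ℝ] E) a
  have hf : Continuous f :=
    (ContinuousLinearMap.apply ℝ E a).continuous.comp
      (Units.continuous_val.comp continuous_subtype_val)
  have hfi : Integrable f μ := hf.integrable_of_hasCompactSupport
    (HasCompactSupport.of_compactSpace f)
  have hsub : Set.range f ⊆ interior C := by
    rintro _ ⟨k, rfl⟩
    exact pc_interior (hK k k.2) ha
  obtain ⟨ε, hε, hεs⟩ := (isCompact_range hf).exists_cthickening_subset_open isOpen_interior hsub
  have hmem : ∀ v : E, ‖v‖ ≤ ε → (∫ k, f k ∂μ) ∈ (fun x => x + v) ⁻¹' C := by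
    intro v hv
    refine (hconv.translate_preimage_left v).integral_mem
      (hclosed.preimage (continuous_id.add continuous_const))
      (Filter.Eventually.of_forall fun k => ?_) hfi
    change f k + v ∈ C
    apply interior_subset
    apply hεs
    refine Metric.mem_cthickening_of_dist_le _ (f k) _ _ (Set.mem_range_self k) ?_
    simpa [dist_eq_norm] using hv
  refine ⟨∫ k, f k ∂μ, ?_, ?_⟩
  · rw [mem_interior_iff_mem_nhds]
    refine Filter.mem_of_superset (Metric.closedBall_mem_nhds _ hε) fun y hy => ?_
    have := hmem (y - ∫ k, f k ∂μ) (by simpa [dist_eq_norm] using hy)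
    simpa using this
  · intro g hg
    rw [← ContinuousLinearMap.integral_comp_comm _ hfi]
    have := integral_mul_left_eq_self (μ := μ) f ⟨g, hg⟩
    rw [← this]
    rfl

lemma stab_le_symm [FiniteDimensional ℝ E] {C : Set E} {a b : E} {g : (E →L[ℝ] E)ˣ}
    (hg : PreservesCone C g) (hgab : (g : E →L[ℝ] E) a = b)
    (hle : coneStab C a ≤ coneStab C b) : coneStab C b ≤ coneStab C a := by
  let V : E → Submodule ℝ E := fun c =>
    { carrier := {x | ∀ k ∈ coneStab C c, (k : E →L[ℝ] E) x = x}
      add_mem' := fun {x y} hx hy k hk => by rw [map_add, hx k hk, hy k hk]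
      zero_mem' := fun k _ => map_zero _
      smul_mem' := fun t x hx k hk => by rw [map_smul, hx k hk] }
  have h1 : V b ≤ V a := fun x hx k hk => hx k (hle hk)
  have h2 : (V a).map ((g : E →L[ℝ] E) : E →ₗ[ℝ] E) ≤ V b := by
    rintro _ ⟨x, hx, rfl⟩ k hk
    have hm : g⁻¹ * k * g ∈ coneStab C a := by
      refine ⟨pc_mul (pc_mul (pc_inv hg) hk.1) hg, ?_⟩
      have e : (k : E →L[ℝ] E) b = b := hk.2
      change ((g⁻¹ : (E →L[ℝ] E)ˣ) : E →L[ℝ] E)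
        ((k : E →L[ℝ] E) ((g : E →L[ℝ] E) a)) = a
      rw [hgab, e, ← hgab, units_inv_apply]
    have e : ((g⁻¹ : (E →L[ℝ] E)ˣ) : E →L[ℝ] E)
        ((k : E →L[ℝ] E) ((g : E →L[ℝ] E) x)) = x := hx _ hm
    have e2 := congrArg (g : E →L[ℝ] E) e
    rwa [units_apply_inv] at e2
  have hinj : Function.Injective ((g : E →L[ℝ] E) : E →ₗ[ℝ] E) :=
    Function.LeftInverse.injective (g := ((g⁻¹ : (E →L[ℝ] E)ˣ) : E →L[ℝ] E)) (units_inv_apply g)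
  have h3 : Module.finrank ℝ (V a) ≤ Module.finrank ℝ (V b) := by
    exact (LinearEquiv.finrank_eq (Submodule.equivMapOfInjective _ hinj (V a))).trans_le
      (Submodule.finrank_mono h2)
  have h4 : V b = V a := Submodule.eq_of_le_of_finrank_le h1 h3
  have h5 : a ∈ V b := by
    rw [h4]; exact fun k hk => hk.2
  exact fun k hk => ⟨hk.1, h5 k hk⟩

end Helpers

/-- For a homogeneous proper cone `C`, a subgroup of `Aut(C)` is a maximal
compact subgroup iff it is the stabilizer of some interior point of `C`; consequently any two
maximal compact subgroups of `Aut(C)` are conjugate. -/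
theorem maximalCompact_iff_stabilizer_and_conjugate
    {E : Type*} [NormedAddCommGroup E] [NormedSpace ℝ E] [FiniteDimensional ℝ E]
    (C : Set E) (hclosed : IsClosed C) (hconv : Convex ℝ C)
    (hcone : ∀ t : ℝ, 0 < t → ∀ x ∈ C, t • x ∈ C)
    (hpointed : C ∩ (-C) = {0})
    (hint : (interior C).Nonempty)
    (hhom : ∀ x ∈ interior C, ∀ y ∈ interior C,
      ∃ g : (E →L[ℝ] E)ˣ, PreservesCone C g ∧ (g : E →L[ℝ] E) x = y) :
    (∀ K : Subgroup (E →L[ℝ] E)ˣ, (∀ g ∈ K, PreservesCone C g) →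
      (IsMaximalCompactConeSubgroup C K ↔
        ∃ a ∈ interior C,
          (K : Set (E →L[ℝ] E)ˣ) =
            {g : (E →L[ℝ] E)ˣ | PreservesCone C g ∧ (g : E →L[ℝ] E) a = a})) ∧
    (∀ K₁ K₂ : Subgroup (E →L[ℝ] E)ˣ,
      IsMaximalCompactConeSubgroup C K₁ → IsMaximalCompactConeSubgroup C K₂ →
        ∃ g : (E →L[ℝ] E)ˣ, PreservesCone C g ∧
          (K₂ : Set (E →L[ℝ] E)ˣ) = (fun k => g * k * g⁻¹) '' (K₁ : Set (E →L[ℝ] E)ˣ)) := by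
  have key : ∀ K : Subgroup (E →L[ℝ] E)ˣ, IsMaximalCompactConeSubgroup C K →
      ∃ a ∈ interior C, K = coneStab C a := by
    rintro K ⟨hK, hKc, hmax⟩
    obtain ⟨b, hb, hfix⟩ := exists_fixed hclosed hconv hint K hK hKc
    exact ⟨b, hb, (hmax (coneStab C b) (fun g hg => hg.1)
      (coneStab_compact hclosed hcone hpointed hb) (fun g hg => ⟨hK g hg, hfix g hg⟩)).symm⟩
  refine ⟨fun K hK => ⟨fun h => ?_, ?_⟩, ?_⟩
  · obtain ⟨a, ha, rfl⟩ := key K h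
    exact ⟨a, ha, rfl⟩
  · rintro ⟨a, ha, hKa⟩
    have hKe : K = coneStab C a := SetLike.coe_injective hKa
    subst hKe
    refine ⟨hK, coneStab_compact hclosed hcone hpointed ha, fun K' hK' hKc' hle => ?_⟩
    obtain ⟨b, hb, hfix⟩ := exists_fixed hclosed hconv hint K' hK' hKc'
    have hle' : K' ≤ coneStab C b := fun g hg => ⟨hK' g hg, hfix g hg⟩
    obtain ⟨g, hg, hgab⟩ := hhom a ha b hb
    exact le_antisymm (hle'.trans (stab_le_symm hg hgab (hle.trans hle'))) hle
  · intro K₁ K₂ h₁ h₂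
    obtain ⟨a, ha, rfl⟩ := key K₁ h₁
    obtain ⟨b, hb, rfl⟩ := key K₂ h₂
    obtain ⟨g, hg, hgab⟩ := hhom a ha b hb
    refine ⟨g, hg, ?_⟩
    ext k
    constructor
    · intro hk
      refine ⟨g⁻¹ * k * g, ⟨pc_mul (pc_mul (pc_inv hg) hk.1) hg, ?_⟩, by group⟩
      have e : (k : E →L[ℝ] E) b = b := hk.2
      change ((g⁻¹ : (E →L[ℝ] E)ˣ) : E →L[ℝ] E)
        ((k : E →L[ℝ] E) ((g : E →L[ℝ] E) a)) = a
      rw [hgab, e, ← hgab, units_inv_apply]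
    · rintro ⟨k, hk, rfl⟩
      refine ⟨pc_mul (pc_mul hg hk.1) (pc_inv hg), ?_⟩
      have e : (k : E →L[ℝ] E) a = a := hk.2
      change (g : E →L[ℝ] E)
        ((k : E →L[ℝ] E) (((g⁻¹ : (E →L[ℝ] E)ˣ) : E →L[ℝ] E) b)) = b
      rw [← hgab, units_inv_apply, e]
end
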